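/- For all nonnegative integers m and n and all t > 0, the sharp double inequality (1/2)·m!·n!/(m+n+1)! < 1/𝔜_{m,n}(t) < m!·n!/(m+n+1)! holds, where 𝔜_{m,n}(t) = t^{m+n+1} h(t) / ∫_0^t u^m (t−u)^n h(u) h(t−u) du. -/

import Mathlib

open MeasureTheory

noncomputable def h (t : ℝ) : ℝ :=
  if t = 0 then 1 / 2 else Real.exp t * (Real.exp t - 1 - t) / (Real.exp t - 1) ^ 2

noncomputable def frakY (m n : ℕ) (t : ℝ) : ℝ :=
  t ^ (m + n + 1) * h t / ∫ u in (0:ℝ)..t, u ^ m * (t - u) ^ n * h u * h (t - u)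

open Filter Topology

/-- A function vanishing (or nonnegative) at `0` with positive derivative on `(0, ∞)` is positive
there. -/
lemma pos_of_hasDerivAt_pos {f f' : ℝ → ℝ} (hf : ContinuousOn f (Set.Ici 0))
    (hd : ∀ x, 0 < x → HasDerivAt f (f' x) x) (h0 : 0 ≤ f 0) (hpos : ∀ x, 0 < x → 0 < f' x)
    {x : ℝ} (hx : 0 < x) : 0 < f x := by
  have hmono : StrictMonoOn f (Set.Ici 0) :=
    strictMonoOn_of_deriv_pos (convex_Ici 0) hf fun y hy => by
      rw [interior_Ici] at hy
      rw [(hd y hy).deriv]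
      exact hpos y hy
  exact h0.trans_lt (hmono Set.self_mem_Ici hx.le hx)

lemma hasDerivAt_linear_mul_exp (a b t : ℝ) :
    HasDerivAt (fun t => (a * t + b) * Real.exp t) ((a * t + (a + b)) * Real.exp t) t := by
  have := (((hasDerivAt_id t).const_mul a).add_const b).mul (Real.hasDerivAt_exp t)
  refine this.congr_deriv ?_
  simp only [id]
  ring

lemma hasDerivAt_linear_mul_exp_mul (a b c t : ℝ) :
    HasDerivAt (fun t => (a * t + b) * Real.exp (c * t))
      ((a * c * t + (a + b * c)) * Real.exp (c * t)) t := by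
  have := (((hasDerivAt_id t).const_mul a).add_const b).mul
    (((hasDerivAt_id t).const_mul c).exp)
  refine this.congr_deriv ?_
  simp only [id]
  ring

lemma linear_mul_exp_add_pos {t : ℝ} (ht : 0 < t) : 0 < (t - 2) * Real.exp t + t + 2 := by
  have step {t : ℝ} (ht : 0 < t) : 0 < (1 * t + -1) * Real.exp t + 1 := by
    refine pos_of_hasDerivAt_pos (f := fun t => (1 * t + -1) * Real.exp t + 1)
      (by fun_prop) (fun x _ => (hasDerivAt_linear_mul_exp 1 (-1) x).add_const 1) (by simp)
      (fun x hx => ?_) ht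
    have := mul_pos hx (Real.exp_pos x)
    linarith
  have := pos_of_hasDerivAt_pos (f := fun t => (1 * t + -2) * Real.exp t + (t + 2))
      (by fun_prop) (fun x _ => (hasDerivAt_linear_mul_exp 1 (-2) x).add
        ((hasDerivAt_id x).add_const 2)) (by simp)
      (fun x hx => by linarith [step hx]) ht
  linarith

/-- Up to a positive factor, minus the second derivative of the logarithm of `h` is positive. -/
lemma exp_polynomial_pos {t : ℝ} (ht : 0 < t) :
    0 < (t - 3) * Real.exp t ^ 3 + (7 + 2 * t) * Real.exp t ^ 2
      - (5 + 3 * t + 2 * t ^ 2) * Real.exp t + 1 := by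
  have e2 (x : ℝ) : Real.exp (2 * x) = Real.exp x ^ 2 := by
    rw [← Real.exp_nat_mul]; norm_num
  have e3 (x : ℝ) : Real.exp (3 * x) = Real.exp x ^ 3 := by
    rw [← Real.exp_nat_mul]; norm_num
  have em (x : ℝ) : Real.exp (-1 * x) * Real.exp x = 1 := by
    rw [← Real.exp_add]; simp
  have p5 {t : ℝ} (ht : 0 < t) : 0 < (24 * t + -4) * Real.exp t + 4 := by
    refine pos_of_hasDerivAt_pos (f := fun t => (24 * t + -4) * Real.exp t + 4)
      (by fun_prop) (fun x _ => (hasDerivAt_linear_mul_exp 24 (-4) x).add_const 4) (by simp)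
      (fun x hx => by positivity) ht
  have p4 {t : ℝ} (ht : 0 < t) : 0 < (24 * t + -28) * Real.exp t + (4 * t + 28) := by
    refine pos_of_hasDerivAt_pos (f := fun t => (24 * t + -28) * Real.exp t + (4 * t + 28))
      (by fun_prop) (fun x _ => (hasDerivAt_linear_mul_exp 24 (-28) x).add
        (((hasDerivAt_id x).const_mul 4).add_const 28)) (by simp)
      (fun x hx => by linarith [p5 hx]) ht
  have p3 {t : ℝ} (ht : 0 < t) :
      0 < (8 * t + -12) * Real.exp (3 * t) + (2 * t + 13) * Real.exp (2 * t) + -1 := by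
    refine pos_of_hasDerivAt_pos
      (f := fun t => (8 * t + -12) * Real.exp (3 * t) + (2 * t + 13) * Real.exp (2 * t) + -1)
      (by fun_prop) (fun x _ => ((hasDerivAt_linear_mul_exp_mul 8 (-12) 3 x).add
        (hasDerivAt_linear_mul_exp_mul 2 13 2 x)).add_const (-1)) (by norm_num)
      (fun x hx => ?_) ht
    have := mul_pos (p4 hx) (pow_pos (Real.exp_pos x) 2)
    rw [e2, e3]
    linarith
  have p2 {t : ℝ} (ht : 0 < t) :
      0 < (4 * t + -8) * Real.exp (2 * t) + (2 * t + 11) * Real.exp (1 * t)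
        + (0 * t + 1) * Real.exp (-1 * t) + (-4) := by
    refine pos_of_hasDerivAt_pos
      (f := fun t => (4 * t + -8) * Real.exp (2 * t) + (2 * t + 11) * Real.exp (1 * t)
        + (0 * t + 1) * Real.exp (-1 * t) + (-4))
      (by fun_prop) (fun x _ => (((hasDerivAt_linear_mul_exp_mul 4 (-8) 2 x).add
        (hasDerivAt_linear_mul_exp_mul 2 11 1 x)).add
        (hasDerivAt_linear_mul_exp_mul 0 1 (-1) x)).add_const (-4)) (by norm_num)
      (fun x hx => ?_) ht
    have := p3 hx
    have hE := Real.exp_pos x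
    refine pos_of_mul_pos_left ?_ hE.le
    rw [e2, e3] at *
    rw [one_mul]
    linear_combination this + em x
  have p1 {t : ℝ} (ht : 0 < t) :
      0 < (2 * t + -5) * Real.exp (2 * t) + (2 * t + 9) * Real.exp (1 * t)
        + (0 * t + -1) * Real.exp (-1 * t) + (-4 * t + -3) := by
    refine pos_of_hasDerivAt_pos
      (f := fun t => (2 * t + -5) * Real.exp (2 * t) + (2 * t + 9) * Real.exp (1 * t)
        + (0 * t + -1) * Real.exp (-1 * t) + (-4 * t + -3))
      (by fun_prop) (fun x _ => (((hasDerivAt_linear_mul_exp_mul 2 (-5) 2 x).add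
        (hasDerivAt_linear_mul_exp_mul 2 9 1 x)).add
        (hasDerivAt_linear_mul_exp_mul 0 (-1) (-1) x)).add
        (((hasDerivAt_id x).const_mul (-4)).add_const (-3))) (by norm_num)
      (fun x hx => by linarith [p2 hx]) ht
  have p0 :
      0 < (1 * t + -3) * Real.exp (2 * t) + (2 * t + 7) * Real.exp (1 * t)
        + (0 * t + 1) * Real.exp (-1 * t) + (-2 * t ^ 2 + (-3 * t + -5)) := by
    refine pos_of_hasDerivAt_pos
      (f := fun t => (1 * t + -3) * Real.exp (2 * t) + (2 * t + 7) * Real.exp (1 * t)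
        + (0 * t + 1) * Real.exp (-1 * t) + (-2 * t ^ 2 + (-3 * t + -5)))
      (by fun_prop) (fun x _ => (((hasDerivAt_linear_mul_exp_mul 1 (-3) 2 x).add
        (hasDerivAt_linear_mul_exp_mul 2 7 1 x)).add
        (hasDerivAt_linear_mul_exp_mul 0 1 (-1) x)).add
        (((hasDerivAt_pow 2 x).const_mul (-2)).add
          (((hasDerivAt_id x).const_mul (-3)).add_const (-5)))) (by norm_num)
      (fun x hx => ?_) ht
    have := p1 hx
    norm_num at this ⊢
    linarith
  have := mul_pos p0 (Real.exp_pos t)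
  rw [e2, one_mul t] at this
  linear_combination this + em t

lemma h_zero : h 0 = 1 / 2 := if_pos rfl

lemma h_of_ne_zero {t : ℝ} (ht : t ≠ 0) :
    h t = Real.exp t * (Real.exp t - 1 - t) / (Real.exp t - 1) ^ 2 := if_neg ht

lemma exp_sub_one_ne_zero {t : ℝ} (ht : t ≠ 0) : Real.exp t - 1 ≠ 0 :=
  sub_ne_zero.2 (Real.exp_eq_one_iff t |>.not.2 ht)

lemma h_pos (t : ℝ) : 0 < h t := by
  rcases eq_or_ne t 0 with rfl | ht
  · norm_num [h_zero]
  · rw [h_of_ne_zero ht]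
    have h1 : 0 < Real.exp t - 1 - t := by linarith [Real.add_one_lt_exp ht]
    have h2 := exp_sub_one_ne_zero ht
    positivity

lemma h_lt_one (t : ℝ) : h t < 1 := by
  rcases eq_or_ne t 0 with rfl | ht
  · norm_num [h_zero]
  · have h2 := exp_sub_one_ne_zero ht
    rw [h_of_ne_zero ht, div_lt_one (by positivity)]
    have h3 := mul_lt_mul_of_pos_left (Real.add_one_lt_exp (neg_ne_zero.2 ht)) (Real.exp_pos t)
    rw [← Real.exp_add, add_neg_cancel, Real.exp_zero] at h3
    linarith

lemma tendsto_exp_sub_one_sub_div_sq :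
    Tendsto (fun t : ℝ => (Real.exp t - 1 - t) / t ^ 2) (𝓝[≠] 0) (𝓝 (1 / 2)) := by
  have h1 := (Real.exp_sub_sum_range_succ_isLittleO_pow 2).tendsto_div_nhds_zero
  have h2 := (h1.mono_left (nhdsWithin_le_nhds (s := {0}ᶜ))).add_const (1 / 2)
  rw [zero_add] at h2
  refine h2.congr' ?_
  filter_upwards [self_mem_nhdsWithin] with t ht
  have ht : t ≠ 0 := ht
  simp only [Finset.sum_range_succ, Finset.sum_range_zero, Nat.factorial]
  field_simp
  push_cast
  ring

lemma tendsto_exp_sub_one_div :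
    Tendsto (fun t : ℝ => (Real.exp t - 1) / t) (𝓝[≠] 0) (𝓝 1) := by
  have := (Real.hasDerivAt_exp 0).tendsto_slope_zero
  simp only [zero_add, Real.exp_zero, smul_eq_mul] at this
  refine this.congr fun t => ?_
  ring

lemma continuous_h : Continuous h := by
  rw [continuous_iff_continuousAt]
  intro t
  rcases eq_or_ne t 0 with rfl | ht
  · rw [continuousAt_iff_punctured_nhds, h_zero]
    have he : Tendsto Real.exp (𝓝[≠] 0) (𝓝 1) := by
      simpa using (Real.continuous_exp.tendsto 0).mono_left nhdsWithin_le_nhds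
    have := (he.mul tendsto_exp_sub_one_sub_div_sq).div (tendsto_exp_sub_one_div.pow 2)
      (by norm_num)
    norm_num at this
    norm_num
    refine this.congr' ?_
    filter_upwards [self_mem_nhdsWithin] with t ht
    have ht : t ≠ 0 := ht
    have := exp_sub_one_ne_zero ht
    simp only [Pi.div_apply, h_of_ne_zero ht]
    field_simp
  · have : ContinuousAt
        (fun t => Real.exp t * (Real.exp t - 1 - t) / (Real.exp t - 1) ^ 2) t :=
      ContinuousAt.div (by fun_prop) (by fun_prop) (pow_ne_zero 2 (exp_sub_one_ne_zero ht))
    refine this.congr ?_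
    filter_upwards [isOpen_ne.mem_nhds ht] with s hs
    exact (h_of_ne_zero hs).symm

lemma tendsto_h_atTop : Tendsto h atTop (𝓝 1) := by
  have h0 : Tendsto (fun t : ℝ => Real.exp (-t)) atTop (𝓝 0) :=
    Real.tendsto_exp_neg_atTop_nhds_zero
  have h1 : Tendsto (fun t : ℝ => t * Real.exp (-t)) atTop (𝓝 0) := by
    simpa using Real.tendsto_pow_mul_exp_neg_atTop_nhds_zero 1
  have := (((tendsto_const_nhds (x := (1 : ℝ))).sub h0).sub h1).div
    (((tendsto_const_nhds (x := (1 : ℝ))).sub h0).pow 2) (by norm_num)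
  norm_num at this
  refine this.congr' ?_
  filter_upwards [eventually_ne_atTop 0] with t ht
  have := exp_sub_one_ne_zero ht
  simp only [Pi.div_apply, h_of_ne_zero ht, Real.exp_neg]
  field_simp

/-- The logarithmic derivative of `h`. -/
noncomputable def logDerivH (t : ℝ) : ℝ :=
  t / (Real.exp t - 1 - t) - 2 / (Real.exp t - 1)

lemma hasDerivAt_log_h {t : ℝ} (ht : 0 < t) :
    HasDerivAt (fun t => Real.log (h t)) (logDerivH t) t := by
  have h1 : Real.exp t - 1 - t ≠ 0 := by linarith [Real.add_one_lt_exp ht.ne']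
  have h2 := exp_sub_one_ne_zero ht.ne'
  have hE := Real.hasDerivAt_exp t
  have hd := ((hasDerivAt_id t).add (((hE.sub_const 1).sub (hasDerivAt_id t)).log h1)).sub
    (((hE.sub_const 1).log h2).const_mul 2)
  refine (hd.congr_deriv ?_).congr_of_eventuallyEq ?_
  · simp only [logDerivH, Pi.sub_apply, id]
    field_simp
    ring
  · filter_upwards [lt_mem_nhds ht] with s hs
    have h1 : Real.exp s - 1 - s ≠ 0 := by linarith [Real.add_one_lt_exp hs.ne']
    have h2 := exp_sub_one_ne_zero hs.ne'
    simp only [Pi.sub_apply, Pi.add_apply, id, h_of_ne_zero hs.ne']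
    rw [Real.log_div (by positivity) (by positivity), Real.log_mul (by positivity) h1,
      Real.log_exp, Real.log_pow]
    norm_num

lemma logDerivH_pos {t : ℝ} (ht : 0 < t) : 0 < logDerivH t := by
  have h1 : 0 < Real.exp t - 1 - t := by linarith [Real.add_one_lt_exp ht.ne']
  have h2 : 0 < Real.exp t - 1 := by linarith
  rw [logDerivH, sub_pos, div_lt_div_iff₀ h2 h1]
  linarith [linear_mul_exp_add_pos ht]

lemma strictAntiOn_logDerivH : StrictAntiOn logDerivH (Set.Ioi 0) := by
  have key (t : ℝ) (ht : 0 < t) : ∃ d < 0, HasDerivAt logDerivH d t := by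
    have h1 : 0 < Real.exp t - 1 - t := by linarith [Real.add_one_lt_exp ht.ne']
    have h2 : 0 < Real.exp t - 1 := by linarith
    have hE := Real.hasDerivAt_exp t
    have hd := ((hasDerivAt_id t).div ((hE.sub_const 1).sub (hasDerivAt_id t)) h1.ne').sub
      ((hasDerivAt_const t (2 : ℝ)).div (hE.sub_const 1) h2.ne')
    refine ⟨_, ?_, hd⟩
    simp only [Pi.sub_apply, id, zero_mul, zero_sub, one_mul, neg_div, sub_neg_eq_add]
    rw [← neg_pos, neg_add, ← sub_eq_add_neg, sub_pos, ← neg_div,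
      div_lt_div_iff₀ (by positivity) (by positivity)]
    linarith [exp_polynomial_pos ht]
  refine strictAntiOn_of_deriv_neg (convex_Ioi 0) (fun t ht => ?_) fun t ht => ?_
  · obtain ⟨d, -, hd⟩ := key t ht
    exact hd.continuousAt.continuousWithinAt
  · rw [interior_Ioi] at ht
    obtain ⟨d, hneg, hd⟩ := key t ht
    rwa [hd.deriv]

lemma h_lt_h {s t : ℝ} (hs : 0 < s) (hst : s < t) : h s < h t := by
  have hmono : StrictMonoOn (fun t => Real.log (h t)) (Set.Ici 0) :=
    strictMonoOn_of_deriv_pos (convex_Ici 0)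
      (continuous_h.log fun t => (h_pos t).ne').continuousOn fun y hy => by
      rw [interior_Ici] at hy
      rw [(hasDerivAt_log_h hy).deriv]
      exact logDerivH_pos hy
  exact (Real.log_lt_log_iff (h_pos s) (h_pos t)).1 (hmono hs.le (hs.trans hst).le hst)

lemma half_mul_h_add_lt {u v : ℝ} (hu : 0 < u) (hv : 0 < v) :
    1 / 2 * h (u + v) < h u * h v := by
  have hc : Continuous fun t => Real.log (h t) := continuous_h.log fun t => (h_pos t).ne'
  have := pos_of_hasDerivAt_pos
    (f := fun u => Real.log (h u) - Real.log (h (u + v)) + (Real.log (h v) - Real.log (1 / 2)))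
    (by have := hc.comp (continuous_add_const v); exact
      ((hc.sub this).add continuous_const).continuousOn)
    (fun x hx => ((hasDerivAt_log_h hx).sub
      ((hasDerivAt_log_h (add_pos hx hv)).comp_add_const x v)).add_const _)
    (by rw [h_zero, zero_add]; linarith)
    (fun x hx => sub_pos.2 (strictAntiOn_logDerivH hx (add_pos hx hv) (by simpa using hv))) hu
  rw [← Real.log_lt_log_iff (by have := h_pos (u + v); positivity)
    (mul_pos (h_pos u) (h_pos v)), Real.log_mul (by norm_num) (h_pos _).ne',
    Real.log_mul (h_pos _).ne' (h_pos _).ne']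
  linarith

lemma integral_pow_mul_one_sub_pow (m n : ℕ) :
    ∫ x in (0:ℝ)..1, x ^ m * (1 - x) ^ n
      = (Nat.factorial m * Nat.factorial n : ℝ) / Nat.factorial (m + n + 1) := by
  induction n generalizing m with
  | zero =>
    simp [Nat.factorial_succ]
    have := Nat.factorial_ne_zero m
    field_simp
  | succ n ih =>
    have hd (x : ℝ) : HasDerivAt (fun x : ℝ => x ^ (m + 1) * (1 - x) ^ (n + 1))
        ((m + 1) * (x ^ m * (1 - x) ^ (n + 1)) - (n + 1) * (x ^ (m + 1) * (1 - x) ^ n)) x := by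
      refine ((hasDerivAt_pow (m + 1) x).mul
        (((hasDerivAt_id x).const_sub 1).pow (n + 1))).congr_deriv ?_
      simp
      ring
    have hi := intervalIntegral.integral_eq_sub_of_hasDerivAt (a := 0) (b := 1)
      (fun x _ => hd x) (Continuous.intervalIntegrable (by fun_prop) _ _)
    rw [intervalIntegral.integral_sub (Continuous.intervalIntegrable (by fun_prop) _ _)
      (Continuous.intervalIntegrable (by fun_prop) _ _), intervalIntegral.integral_const_mul,
      intervalIntegral.integral_const_mul, ih (m + 1)] at hi
    simp at hi
    have hm : (m + 1 : ℝ) ≠ 0 := by positivity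
    apply mul_left_cancel₀ hm
    rw [sub_eq_zero.1 hi, show m + 1 + n + 1 = m + (n + 1) + 1 by ring]
    push_cast [Nat.factorial_succ m, Nat.factorial_succ n]
    ring

lemma one_div_frakY_eq (m n : ℕ) {t : ℝ} (ht : 0 < t) :
    1 / frakY m n t
      = ∫ x in (0:ℝ)..1, x ^ m * (1 - x) ^ n * (h (t * x) * h (t * (1 - x)) / h t) := by
  have hs := intervalIntegral.integral_comp_mul_left
    (a := 0) (b := 1) (fun u => u ^ m * (t - u) ^ n * h u * h (t - u)) ht.ne'
  rw [mul_zero, mul_one, smul_eq_mul, eq_inv_mul_iff_mul_eq₀ ht.ne'] at hs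
  have hh := (h_pos t).ne'
  have ht' := ht.ne'
  rw [frakY, one_div_div, ← hs, ← intervalIntegral.integral_const_mul,
    ← intervalIntegral.integral_div]
  refine intervalIntegral.integral_congr fun x _ => ?_
  simp only [show t - t * x = t * (1 - x) by ring, mul_pow]
  field_simp
  ring

/-- If the normalised product of values of `h` converges pointwise along a filter, so does
`1 / frakY m n`. -/
lemma tendsto_one_div_frakY (m n : ℕ) {l : Filter ℝ} [l.IsCountablyGenerated] {c : ℝ}
    (hl : ∀ᶠ t in l, 0 < t)
    (hc : ∀ x ∈ Set.Ioo (0:ℝ) 1,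
      Tendsto (fun t => h (t * x) * h (t * (1 - x)) / h t) l (𝓝 c)) :
    Tendsto (fun t => 1 / frakY m n t) l
      (𝓝 (c * ((Nat.factorial m * Nat.factorial n : ℝ) / Nat.factorial (m + n + 1)))) := by
  have hch := continuous_h
  rw [mul_comm, ← integral_pow_mul_one_sub_pow, ← intervalIntegral.integral_mul_const]
  have := intervalIntegral.tendsto_integral_filter_of_dominated_convergence
    (μ := volume) (a := 0) (b := 1) (l := l)
    (F := fun t x => x ^ m * (1 - x) ^ n * (h (t * x) * h (t * (1 - x)) / h t))
    (f := fun x => x ^ m * (1 - x) ^ n * c) (fun _ => 1)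
    (Eventually.of_forall fun t => Continuous.aestronglyMeasurable (by fun_prop))
    ?_ (by simp) ?_
  · refine this.congr' ?_
    filter_upwards [hl] with t ht using (one_div_frakY_eq m n ht).symm
  · filter_upwards [hl] with t ht
    filter_upwards [Measure.ae_ne volume (1:ℝ)] with x hx1 hx
    rw [Set.uIoc_of_le zero_le_one] at hx
    have h1 : x < 1 := lt_of_le_of_ne hx.2 hx1
    have h0 : 0 < 1 - x := sub_pos.2 h1
    have hx0 := hx.1
    have hp1 := h_pos (t * x)
    have hp2 := h_pos (t * (1 - x))
    have hp3 := h_pos t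
    rw [Real.norm_of_nonneg (by positivity)]
    have b1 : x ^ m * (1 - x) ^ n ≤ 1 :=
      mul_le_one₀ (pow_le_one₀ hx0.le h1.le) (by positivity)
        (pow_le_one₀ h0.le (by linarith))
    refine mul_le_one₀ b1 (by positivity) ?_
    rw [div_le_one hp3]
    calc h (t * x) * h (t * (1 - x)) ≤ h (t * x) * 1 := by
          gcongr; exact (h_lt_one _).le
      _ ≤ h t := by
          rw [mul_one]; exact (h_lt_h (by positivity) (by nlinarith)).le
  · filter_upwards [Measure.ae_ne volume (1:ℝ)] with x hx1 hx
    rw [Set.uIoc_of_le zero_le_one] at hx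
    exact (hc x ⟨hx.1, lt_of_le_of_ne hx.2 hx1⟩).const_mul _

lemma tendsto_one_div_frakY_nhdsGT_zero (m n : ℕ) :
    Tendsto (fun t => 1 / frakY m n t) (𝓝[>] 0)
      (𝓝 (1 / 2 * ((Nat.factorial m * Nat.factorial n : ℝ) / Nat.factorial (m + n + 1)))) := by
  refine tendsto_one_div_frakY m n self_mem_nhdsWithin fun x _ => ?_
  have hch := continuous_h
  have : Continuous fun t => h (t * x) * h (t * (1 - x)) / h t :=
    Continuous.div (by fun_prop) hch fun t => (h_pos t).ne'
  have h0 := this.tendsto 0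
  norm_num [h_zero] at h0
  norm_num
  exact h0.mono_left nhdsWithin_le_nhds

lemma tendsto_one_div_frakY_atTop (m n : ℕ) :
    Tendsto (fun t => 1 / frakY m n t) atTop
      (𝓝 ((Nat.factorial m * Nat.factorial n : ℝ) / Nat.factorial (m + n + 1))) := by
  rw [← one_mul ((_ : ℝ) / _)]
  refine tendsto_one_div_frakY m n (eventually_gt_atTop 0) fun x hx => ?_
  have hlim {a : ℝ} (ha : 0 < a) : Tendsto (fun t => h (t * a)) atTop (𝓝 1) :=
    tendsto_h_atTop.comp (tendsto_id.atTop_mul_const ha)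
  simpa [Pi.div_def] using ((hlim hx.1).mul (hlim (sub_pos.2 hx.2))).div tendsto_h_atTop one_ne_zero

/-- Strict comparison of integrals over `[0, 1]` of two continuous functions weighted by
`x ^ m * (1 - x) ^ n`. -/
lemma integral_weight_mul_lt (m n : ℕ) {f g : ℝ → ℝ} (hf : Continuous f) (hg : Continuous g)
    (hlt : ∀ x ∈ Set.Ioo (0:ℝ) 1, f x < g x) :
    ∫ x in (0:ℝ)..1, x ^ m * (1 - x) ^ n * f x < ∫ x in (0:ℝ)..1, x ^ m * (1 - x) ^ n * g x := by
  have hif : IntervalIntegrable (fun x => x ^ m * (1 - x) ^ n * f x) volume 0 1 :=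
    Continuous.intervalIntegrable (by fun_prop) _ _
  have hig : IntervalIntegrable (fun x => x ^ m * (1 - x) ^ n * g x) volume 0 1 :=
    Continuous.intervalIntegrable (by fun_prop) _ _
  rw [← sub_pos, ← intervalIntegral.integral_sub hig hif]
  refine intervalIntegral.intervalIntegral_pos_of_pos_on (hig.sub hif) (fun x hx => ?_) one_pos
  have h0 : 0 < 1 - x := sub_pos.2 hx.2
  have hx0 := hx.1
  have := hlt x hx
  rw [sub_pos]
  gcongr

theorem one_div_frakY_bounds (m n : ℕ) :
    (∀ t ∈ Set.Ioi (0:ℝ),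
      (1 / 2) * ((Nat.factorial m * Nat.factorial n : ℝ) / Nat.factorial (m + n + 1))
        < 1 / frakY m n t ∧
      1 / frakY m n t
        < (Nat.factorial m * Nat.factorial n : ℝ) / Nat.factorial (m + n + 1)) ∧
    (∀ L : ℝ, (∀ t ∈ Set.Ioi (0:ℝ), L < 1 / frakY m n t) →
      L ≤ (1 / 2) * ((Nat.factorial m * Nat.factorial n : ℝ) / Nat.factorial (m + n + 1))) ∧
    (∀ U : ℝ, (∀ t ∈ Set.Ioi (0:ℝ), 1 / frakY m n t < U) →
      (Nat.factorial m * Nat.factorial n : ℝ) / Nat.factorial (m + n + 1) ≤ U) := by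
  have hch := continuous_h
  refine ⟨fun t (ht : 0 < t) => ?_, fun L hL => ?_, fun U hU => ?_⟩
  · have hc : Continuous fun x => h (t * x) * h (t * (1 - x)) / h t := by fun_prop
    have hp := h_pos t
    rw [one_div_frakY_eq m n ht, ← integral_pow_mul_one_sub_pow]
    constructor
    · rw [mul_comm, ← intervalIntegral.integral_mul_const]
      refine integral_weight_mul_lt m n continuous_const hc fun x hx => ?_
      rw [lt_div_iff₀ hp]
      have := half_mul_h_add_lt (mul_pos ht hx.1) (mul_pos ht (sub_pos.2 hx.2))
      rwa [show t * x + t * (1 - x) = t by ring] at this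
    · have := integral_weight_mul_lt m n hc (continuous_const (y := (1 : ℝ))) fun x hx => ?_
      · simpa using this
      rw [div_lt_one hp]
      have hx0 := mul_pos ht hx.1
      calc h (t * x) * h (t * (1 - x)) < h (t * x) :=
            mul_lt_of_lt_one_right (h_pos _) (h_lt_one _)
        _ < h t := h_lt_h hx0 (by nlinarith [hx.2])
  · refine ge_of_tendsto (tendsto_one_div_frakY_nhdsGT_zero m n) ?_
    filter_upwards [self_mem_nhdsWithin] with t ht using (hL t ht).le
  · refine le_of_tendsto (tendsto_one_div_frakY_atTop m n) ?_
    filter_upwards [eventually_gt_atTop 0] with t ht using (hU t ht).le
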